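/- For every 1 ≤ r ≤ n−1 and every t ∈ ℝ, B_r(t) = (r/n)·∫_{{x : F(x) < 1}} [f(max{x, t}) / (1 − F(x))]·f_{(n−r:n)}(x) dx. (The marginal benefit coefficient at rank r, divided by r, equals 1/n times the expectation of the modified hazard rate f(max{x,t})/(1−F(x)) over the (r-th highest of n) order statistic.) -/

import Mathlib

open MeasureTheory

/-- The CDF associated with a density `f`. -/
noncomputable def Fcdf (f : ℝ → ℝ) (x : ℝ) : ℝ := ∫ u in Set.Iic x, f u

/-- `F_{(j:m)}`, the CDF of the `j`-th smallest of `m` i.i.d. draws (binomial-sum form),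
with the convention `F_{(0:m)} ≡ 1`. -/
noncomputable def Fos (f : ℝ → ℝ) (j m : ℕ) (x : ℝ) : ℝ :=
  if j = 0 then 1
  else ∑ k ∈ Finset.Icc j m, (m.choose k : ℝ) * Fcdf f x ^ k * (1 - Fcdf f x) ^ (m - k)

/-- `f_{(j:m)}`, the density of the `j`-th smallest of `m` i.i.d. draws,
with the convention `f_{(0:m)} ≡ 0`. -/
noncomputable def fos (f : ℝ → ℝ) (j m : ℕ) (x : ℝ) : ℝ :=
  if j = 0 then 0
  else (j : ℝ) * (m.choose j : ℝ) * Fcdf f x ^ (j - 1) * (1 - Fcdf f x) ^ (m - j) * f x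

/-- The marginal-benefit coefficient `B_r(t)`. -/
noncomputable def Bcoef (f : ℝ → ℝ) (n r : ℕ) (t : ℝ) : ℝ :=
  f t * Fos f (n - r) (n - 1) t + ∫ x in Set.Ioi t, f x * fos f (n - r) (n - 1) x

/-- The marginal benefit of effort `g(t; v)` with threshold `t` and prize schedule `v`. -/
noncomputable def gmb (f : ℝ → ℝ) (n : ℕ) (v : ℕ → ℝ) (t : ℝ) : ℝ :=
  ∑ r ∈ Finset.Icc 1 n, Bcoef f n r t * (v r - v (r + 1))

/-- A noise density: nonnegative, bounded, integrating to one, vanishing outside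
`[xl, xu]` and continuous there.  The endpoints may be infinite. -/
def IsNoiseDensity (f : ℝ → ℝ) (xl xu : EReal) : Prop :=
  xl < xu ∧ (∀ x, 0 ≤ f x) ∧ (∃ M, ∀ x, f x ≤ M) ∧ (∫ x, f x = 1) ∧
    (∀ x : ℝ, ((x : EReal) < xl ∨ xu < (x : EReal)) → f x = 0) ∧
    ContinuousOn f {x : ℝ | xl ≤ (x : EReal) ∧ (x : EReal) ≤ xu}

/-- A prize schedule `v = (v 1, …, v n)`: nonincreasing, nonnegative, summing to one,
with the convention `v (n+1) = 0`. -/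
def IsPrizeSchedule (n : ℕ) (v : ℕ → ℝ) : Prop :=
  (∀ r ∈ Finset.Icc 1 n, 0 ≤ v r) ∧ (∀ r, 1 ≤ r → r < n → v (r + 1) ≤ v r) ∧
    (∑ r ∈ Finset.Icc 1 n, v r = 1) ∧ v (n + 1) = 0

/-- `m` is a mode of `f`. -/
def IsMode (f : ℝ → ℝ) (m : ℝ) : Prop :=
  ∃ a b : ℝ, a < m ∧ m < b ∧ MonotoneOn f (Set.Icc a m) ∧ AntitoneOn f (Set.Icc m b) ∧
    f a < f m ∧ f b < f m

/-- `f` is piecewise monotone: away from finitely many points it is monotone. -/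
def PiecewiseMonotone (f : ℝ → ℝ) : Prop :=
  ∃ s : Finset ℝ, ∀ a b : ℝ, a < b → (∀ c ∈ s, c ∉ Set.Ioo a b) →
    MonotoneOn f (Set.Ioo a b) ∨ AntitoneOn f (Set.Ioo a b)

open Filter Topology Set

namespace IsNoiseDensity

variable {f : ℝ → ℝ} {xl xu : EReal}

theorem integrable (hf : IsNoiseDensity f xl xu) : Integrable f := by
  by_contra h
  have h1 := hf.2.2.2.1
  rw [integral_undef h] at h1
  exact zero_ne_one h1

theorem Fcdf_nonneg (hf : IsNoiseDensity f xl xu) (x : ℝ) : 0 ≤ Fcdf f x :=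
  integral_nonneg hf.2.1

theorem Fcdf_le_one (hf : IsNoiseDensity f xl xu) (x : ℝ) : Fcdf f x ≤ 1 := by
  rw [← hf.2.2.2.1]
  exact setIntegral_le_integral hf.integrable (Eventually.of_forall hf.2.1)

theorem Fcdf_eq (hf : IsNoiseDensity f xl xu) (x : ℝ) :
    Fcdf f x = Fcdf f 0 + ∫ u in (0 : ℝ)..x, f u := by
  rw [← intervalIntegral.integral_Iic_sub_Iic hf.integrable.integrableOn
    hf.integrable.integrableOn]
  simp [Fcdf]

theorem continuous_Fcdf (hf : IsNoiseDensity f xl xu) : Continuous (Fcdf f) := by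
  rw [funext hf.Fcdf_eq]
  exact continuous_const.add (intervalIntegral.continuous_primitive
    (fun _ _ => hf.integrable.intervalIntegrable) 0)

/-- A noise density is continuous except possibly at the endpoints of its support. -/
theorem continuousAt (hf : IsNoiseDensity f xl xu) {x : ℝ} (hl : (x : EReal) ≠ xl)
    (hu : (x : EReal) ≠ xu) : ContinuousAt f x := by
  obtain ⟨-, -, -, -, hz, hc⟩ := hf
  rcases lt_or_gt_of_ne hl with h | h
  · have : f =ᶠ[𝓝 x] fun _ => 0 := by
      filter_upwards [(isOpen_Iio.preimage continuous_coe_real_ereal).mem_nhds h] with y hy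
      exact hz y (Or.inl hy)
    exact this.continuousAt
  rcases lt_or_gt_of_ne hu with h' | h'
  · refine hc.continuousAt ?_
    filter_upwards [(isOpen_Ioi.preimage continuous_coe_real_ereal).mem_nhds h,
      (isOpen_Iio.preimage continuous_coe_real_ereal).mem_nhds h'] with y hy hy'
    exact ⟨le_of_lt hy, le_of_lt hy'⟩
  · have : f =ᶠ[𝓝 x] fun _ => 0 := by
      filter_upwards [(isOpen_Ioi.preimage continuous_coe_real_ereal).mem_nhds h'] with y hy
      exact hz y (Or.inr hy)
    exact this.continuousAt

theorem hasDerivAt_Fcdf (hf : IsNoiseDensity f xl xu) {x : ℝ}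
    (hx : x ∉ ({xl.toReal, xu.toReal} : Set ℝ)) : HasDerivAt (Fcdf f) (f x) x := by
  have hc : ContinuousAt f x := by
    apply hf.continuousAt <;> rintro rfl <;> simp at hx
  rw [funext hf.Fcdf_eq]
  exact (intervalIntegral.integral_hasDerivAt_right hf.integrable.intervalIntegrable
    hf.integrable.aestronglyMeasurable.stronglyMeasurableAtFilter hc).const_add _

theorem ae_eq_zero_of_Fcdf_eq_one (hf : IsNoiseDensity f xl xu) :
    ∀ᵐ x, ¬ Fcdf f x < 1 → f x = 0 := by
  have hs : ({xl.toReal, xu.toReal} : Set ℝ).Countable := (Set.toFinite _).countable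
  filter_upwards [hs.ae_notMem volume] with x hx hF
  have hmax : IsLocalMax (Fcdf f) x :=
    Eventually.of_forall fun y => (hf.Fcdf_le_one y).trans (not_lt.1 hF)
  exact hmax.hasDerivAt_eq_zero (hf.hasDerivAt_Fcdf hx)

theorem integrable_fos (hf : IsNoiseDensity f xl xu) (j m : ℕ) : Integrable (fos f j m) := by
  by_cases hj : j = 0
  · simp [funext fun x => show fos f j m x = 0 by simp [fos, hj]]
  simp only [funext fun x => show fos f j m x = _ by rw [fos, if_neg hj]]
  refine hf.integrable.bdd_mul (c := (j : ℝ) * (m.choose j : ℝ)) ?_ (Eventually.of_forall ?_)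
  · have := hf.continuous_Fcdf
    exact Continuous.aestronglyMeasurable (by fun_prop)
  · intro x
    have h0 := hf.Fcdf_nonneg x
    have h1 := hf.Fcdf_le_one x
    have h2 : 0 ≤ 1 - Fcdf f x := by linarith
    rw [Real.norm_of_nonneg (by positivity), mul_assoc]
    exact mul_le_of_le_one_right (by positivity)
      (mul_le_one₀ (pow_le_one₀ h0 h1) (by positivity) (pow_le_one₀ h2 (by linarith)))

end IsNoiseDensity

/-- The derivative of an upper binomial tail, as a function of the success probability. -/
theorem hasDerivAt_binomialTail {j m : ℕ} (hjm : j ≤ m) (p : ℝ) :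
    HasDerivAt (fun p : ℝ => ∑ k ∈ Finset.Icc j m, (m.choose k : ℝ) * p ^ k * (1 - p) ^ (m - k))
      ((j : ℝ) * (m.choose j : ℝ) * p ^ (j - 1) * (1 - p) ^ (m - j)) p := by
  set g : ℕ → ℝ := fun k => (k : ℝ) * (m.choose k : ℝ) * p ^ (k - 1) * (1 - p) ^ (m - k) with hg
  have hterm : ∀ k ∈ Finset.Icc j m,
      HasDerivAt (fun p : ℝ => (m.choose k : ℝ) * p ^ k * (1 - p) ^ (m - k))
        (-(g (k + 1) - g k)) p := by
    intro k hk
    have hkm := (Finset.mem_Icc.1 hk).2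
    have hchoose : ((k + 1 : ℕ) : ℝ) * (m.choose (k + 1) : ℝ)
        = (m.choose k : ℝ) * ((m - k : ℕ) : ℝ) := by
      rw [mul_comm]
      exact_mod_cast Nat.choose_succ_right_eq m k
    have h1 : HasDerivAt (fun p : ℝ => (m.choose k : ℝ) * p ^ k) _ p :=
      (hasDerivAt_pow k p).const_mul _
    have h2 : HasDerivAt (fun p : ℝ => (1 - p) ^ (m - k)) _ p :=
      ((hasDerivAt_id p).const_sub 1).pow (m - k)
    refine (h1.fun_mul h2).congr_deriv ?_
    simp only [hg, hchoose, Nat.add_sub_cancel, Nat.sub_sub, id]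
    ring
  refine (HasDerivAt.fun_sum hterm).congr_deriv ?_
  rw [Finset.sum_neg_distrib, ← Finset.Ico_succ_right_eq_Icc, Nat.succ_eq_succ,
    Finset.sum_Ico_sub g (by simp; omega)]
  simp [hg]

theorem tendsto_Fcdf_atBot (f : ℝ → ℝ) : Tendsto (Fcdf f) atBot (𝓝 0) :=
  tendsto_integral_Iic_zero tendsto_id

theorem continuous_Fos {f : ℝ → ℝ} (hF : Continuous (Fcdf f)) (j m : ℕ) :
    Continuous (Fos f j m) := by
  unfold Fos
  split_ifs <;> fun_prop

theorem tendsto_Fos_atBot (f : ℝ → ℝ) {j : ℕ} (hj : j ≠ 0) (m : ℕ) :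
    Tendsto (Fos f j m) atBot (𝓝 0) := by
  have hP : Continuous fun p : ℝ =>
      ∑ k ∈ Finset.Icc j m, (m.choose k : ℝ) * p ^ k * (1 - p) ^ (m - k) := by fun_prop
  have hlim := (hP.tendsto 0).comp (tendsto_Fcdf_atBot f)
  have h0 : ∑ k ∈ Finset.Icc j m, (m.choose k : ℝ) * 0 ^ k * (1 - 0) ^ (m - k) = 0 := by
    refine Finset.sum_eq_zero fun k hk => ?_
    have := (Finset.mem_Icc.1 hk).1
    rw [zero_pow (by omega)]
    simp
  rw [h0] at hlim
  refine hlim.congr fun x => ?_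
  simp [Fos, hj]

/-- `fos f j m` is the density of the distribution function `Fos f j m`. -/
theorem IsNoiseDensity.integral_Iic_fos {f : ℝ → ℝ} {xl xu : EReal}
    (hf : IsNoiseDensity f xl xu) {j m : ℕ} (hj : j ≠ 0) (hjm : j ≤ m) (t : ℝ) :
    ∫ x in Iic t, fos f j m x = Fos f j m t := by
  have hs : ({xl.toReal, xu.toReal} : Set ℝ).Countable := (Set.toFinite _).countable
  have hFTC : ∀ a : ℝ, ∫ x in a..t, fos f j m x = Fos f j m t - Fos f j m a := by
    intro a
    refine integral_eq_of_hasDerivAt_off_countable _ _ hs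
      (continuous_Fos hf.continuous_Fcdf j m).continuousOn (fun x hx => ?_)
      (hf.integrable_fos j m).intervalIntegrable
    have h := (hasDerivAt_binomialTail hjm (Fcdf f x)).comp x (hf.hasDerivAt_Fcdf hx.2)
    have hFos : Fos f j m = (fun p : ℝ =>
        ∑ k ∈ Finset.Icc j m, (m.choose k : ℝ) * p ^ k * (1 - p) ^ (m - k)) ∘ Fcdf f := by
      ext y
      simp [Fos, hj]
    rw [hFos, fos, if_neg hj]
    exact h
  have h1 := intervalIntegral_tendsto_integral_Iic t
    (hf.integrable_fos j m).integrableOn tendsto_id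
  have h2 : Tendsto (fun a => Fos f j m t - Fos f j m a) atBot (𝓝 (Fos f j m t - 0)) :=
    (tendsto_Fos_atBot f hj m).const_sub _
  rw [sub_zero] at h2
  exact tendsto_nhds_unique h1 (h2.congr fun a => (hFTC a).symm)

/-- Lowering the sample size by one reweights the order-statistic density by `1 / (1 - F)`. -/
theorem fos_sub_one_eq {f : ℝ → ℝ} {n r : ℕ} (hr1 : 1 ≤ r) (hr2 : r ≤ n - 1) {x : ℝ}
    (hx : Fcdf f x < 1) :
    fos f (n - r) (n - 1) x = (r : ℝ) / n * ((1 - Fcdf f x)⁻¹ * fos f (n - r) n x) := by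
  obtain ⟨s, rfl⟩ : ∃ s, r = s + 1 := ⟨r - 1, by omega⟩
  obtain ⟨j, rfl⟩ : ∃ j, n = j + 1 + (s + 1) := ⟨n - (s + 1) - 1, by omega⟩
  have e1 : j + 1 + (s + 1) - (s + 1) = j + 1 := by omega
  have e2 : j + 1 + (s + 1) - 1 = j + 1 + s := by omega
  have e3 : j + 1 + s - (j + 1) = s := by omega
  have e4 : j + 1 + (s + 1) - (j + 1) = s + 1 := by omega
  have hF : 1 - Fcdf f x ≠ 0 := by linarith
  have hchoose : ((j + 1 + (s + 1) : ℕ) : ℝ) * ((j + 1 + s).choose (j + 1) : ℝ)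
      = ((j + 1 + (s + 1)).choose (j + 1) : ℝ) * ((s + 1 : ℕ) : ℝ) := by
    have h := Nat.add_one_mul_choose_eq (j + 1 + s) s
    rw [add_assoc (j + 1) s 1, ← Nat.choose_symm_add, ← Nat.choose_symm_add] at h
    exact_mod_cast h
  have hn : ((j + 1 + (s + 1) : ℕ) : ℝ) ≠ 0 := by positivity
  rw [e1, e2, fos, fos, if_neg j.succ_ne_zero, if_neg j.succ_ne_zero, e3, e4,
    ← mul_right_inj' hn]
  rw [show ∀ N c P Q y : ℝ, N * (((j + 1 : ℕ) : ℝ) * c * P * Q * y)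
    = (N * c) * (((j + 1 : ℕ) : ℝ) * P * Q * y) by intros; ring, hchoose]
  field_simp
  ring

/-- For `1 ≤ r ≤ n-1` and any `t`,
`B_r(t) = (r/n) ∫_{F<1} [f(max{x,t})/(1-F(x))] f_{(n-r:n)}(x) dx`. -/
theorem stmt4 (n : ℕ) (hn : 2 ≤ n) (f : ℝ → ℝ) (xl xu : EReal)
    (hf : IsNoiseDensity f xl xu) (r : ℕ) (hr1 : 1 ≤ r) (hr2 : r ≤ n - 1) (t : ℝ) :
    Bcoef f n r t =
      (r : ℝ) / (n : ℝ) *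
        ∫ x in {x : ℝ | Fcdf f x < 1}, f (max x t) / (1 - Fcdf f x) * fos f (n - r) n x := by
  have hj : n - r ≠ 0 := by omega
  set h : ℝ → ℝ := fun x => f (max x t) * fos f (n - r) (n - 1) x with hh
  have hfos := hf.integrable_fos (n - r) (n - 1)
  have hIic : EqOn h (fun x => f t * fos f (n - r) (n - 1) x) (Iic t) := fun x hx => by
    simp [hh, max_eq_right (mem_Iic.1 hx)]
  have hIoi : EqOn h (fun x => f x * fos f (n - r) (n - 1) x) (Ioi t) := fun x hx => by
    simp [hh, max_eq_left (le_of_lt (mem_Ioi.1 hx))]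
  obtain ⟨M, hM⟩ := hf.2.2.1
  have hint1 : IntegrableOn h (Iic t) :=
    (hfos.const_mul (f t)).integrableOn.congr_fun hIic.symm measurableSet_Iic
  have hint2 : IntegrableOn h (Ioi t) := by
    refine IntegrableOn.congr_fun (Integrable.integrableOn ?_) hIoi.symm measurableSet_Ioi
    refine hfos.bdd_mul (c := M) hf.integrable.aestronglyMeasurable (Eventually.of_forall ?_)
    intro x
    rw [Real.norm_of_nonneg (hf.2.1 x)]
    exact hM x
  have hB : Bcoef f n r t = ∫ x, h x := by
    rw [← intervalIntegral.integral_Iic_add_Ioi hint1 hint2,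
      setIntegral_congr_fun measurableSet_Iic hIic, setIntegral_congr_fun measurableSet_Ioi hIoi,
      integral_const_mul, hf.integral_Iic_fos hj (by omega), Bcoef]
  have hzero : ∀ᵐ x, x ∉ {x : ℝ | Fcdf f x < 1} → h x = 0 := by
    filter_upwards [hf.ae_eq_zero_of_Fcdf_eq_one] with x hx hF
    simp [hh, fos, hx hF]
  rw [hB, ← setIntegral_eq_integral_of_ae_compl_eq_zero hzero, ← integral_const_mul]
  refine setIntegral_congr_fun (measurableSet_lt hf.continuous_Fcdf.measurable
    measurable_const) fun x hx => ?_
  simp only [hh]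
  rw [fos_sub_one_eq hr1 hr2 hx]
  ring
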